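/- Fix n ≥ 2, R > 0, and a smooth function g : ℝ → ℝ with g(r) = π for all r in some neighbourhood of (−∞, 0] and g(r) = 0 for all r ≥ R. Define τ : ℝⁿ × ℝⁿ → ℝⁿ × ℝⁿ by τ(q, p) := (cos(g(‖p‖))·q + (sin(g(‖p‖))/‖p‖)·p, −‖p‖ sin(g(‖p‖))·q + cos(g(‖p‖))·p) for p ≠ 0, and τ(q, 0) := (−q, 0). Then: (i) τ is infinitely differentiable (C^∞) on all of ℝⁿ × ℝⁿ; (ii) τ maps the set T := {(q, p) ∈ ℝⁿ × ℝⁿ : ⟨q, q⟩ = 1, ⟨q, p⟩ = 0} bijectively onto itself; (iii) τ(q, p) = (q, p) whenever ‖p‖ ≥ R. -/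

import Mathlib

open scoped RealInnerProductSpace
open Classical

/-- The model (right-handed) Dehn twist on `T*S^{n-1} ⊂ ℝⁿ × ℝⁿ`, determined by a profile
function `g`; for `p ≠ 0` it is the time-`g(‖p‖)` normalised geodesic flow, and on the zero
section it is the antipodal map. -/
noncomputable def dehnTwist (n : ℕ) (g : ℝ → ℝ)
    (x : EuclideanSpace ℝ (Fin n) × EuclideanSpace ℝ (Fin n)) :
    EuclideanSpace ℝ (Fin n) × EuclideanSpace ℝ (Fin n) :=
  if x.2 = 0 then (-x.1, 0)
  else
    (Real.cos (g ‖x.2‖) • x.1 + (Real.sin (g ‖x.2‖) / ‖x.2‖) • x.2,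
     (-(‖x.2‖ * Real.sin (g ‖x.2‖))) • x.1 + Real.cos (g ‖x.2‖) • x.2)

/-- The cotangent bundle `T*S^{n-1}` realised inside `ℝⁿ × ℝⁿ`. -/
def cotangentSphere (n : ℕ) :
    Set (EuclideanSpace ℝ (Fin n) × EuclideanSpace ℝ (Fin n)) :=
  {x | ⟪x.1, x.1⟫ = (1 : ℝ) ∧ ⟪x.1, x.2⟫ = (0 : ℝ)}

section DehnTwist

variable {n : ℕ} {g : ℝ → ℝ} {x : EuclideanSpace ℝ (Fin n) × EuclideanSpace ℝ (Fin n)}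

theorem dehnTwist_of_snd_eq_zero (hx : x.2 = 0) : dehnTwist n g x = (-x.1, 0) :=
  if_pos hx

theorem dehnTwist_of_snd_ne_zero (hx : x.2 ≠ 0) :
    dehnTwist n g x =
      (Real.cos (g ‖x.2‖) • x.1 + (Real.sin (g ‖x.2‖) / ‖x.2‖) • x.2,
       (-(‖x.2‖ * Real.sin (g ‖x.2‖))) • x.1 + Real.cos (g ‖x.2‖) • x.2) :=
  if_neg hx

theorem norm_dehnTwist_snd (hx : x ∈ cotangentSphere n) :
    ‖(dehnTwist n g x).2‖ = ‖x.2‖ := by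
  by_cases h : x.2 = 0
  · simp [dehnTwist_of_snd_eq_zero h, h]
  · obtain ⟨h₁, h₂⟩ := hx
    rw [← sq_eq_sq₀ (norm_nonneg _) (norm_nonneg _), ← real_inner_self_eq_norm_sq,
      dehnTwist_of_snd_ne_zero h]
    simp only [inner_add_left, inner_add_right, real_inner_smul_left, real_inner_smul_right,
      real_inner_comm x.1 x.2, h₁, h₂, real_inner_self_eq_norm_sq x.2]
    linear_combination ‖x.2‖ ^ 2 * Real.sin_sq_add_cos_sq (g ‖x.2‖)

theorem mapsTo_dehnTwist (n : ℕ) (g : ℝ → ℝ) :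
    Set.MapsTo (dehnTwist n g) (cotangentSphere n) (cotangentSphere n) := by
  rintro x ⟨h₁, h₂⟩
  by_cases h : x.2 = 0
  · rw [dehnTwist_of_snd_eq_zero h]
    exact ⟨by simpa using h₁, by simp⟩
  · have hp : ‖x.2‖ ≠ 0 := norm_ne_zero_iff.mpr h
    rw [dehnTwist_of_snd_ne_zero h]
    constructor <;>
    simp only [inner_add_left, inner_add_right, real_inner_smul_left, real_inner_smul_right,
      real_inner_comm x.1 x.2, h₁, h₂, real_inner_self_eq_norm_sq x.2]
    · field_simp
      linear_combination ‖x.2‖ * Real.sin_sq_add_cos_sq (g ‖x.2‖)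
    · field_simp
      ring

theorem leftInvOn_dehnTwist {g' : ℝ → ℝ} (h : ∀ r, g' r = -g r) :
    Set.LeftInvOn (dehnTwist n g') (dehnTwist n g) (cotangentSphere n) := by
  intro x hx
  have hnorm := norm_dehnTwist_snd (g := g) hx
  by_cases hp : x.2 = 0
  · rw [dehnTwist_of_snd_eq_zero hp, dehnTwist_of_snd_eq_zero rfl]
    exact Prod.ext (neg_neg _) hp.symm
  · have hr : ‖x.2‖ ≠ 0 := norm_ne_zero_iff.mpr hp
    have hp' : (dehnTwist n g x).2 ≠ 0 := by rwa [← norm_ne_zero_iff, hnorm]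
    have hcs := Real.sin_sq_add_cos_sq (g ‖x.2‖)
    rw [dehnTwist_of_snd_ne_zero hp', hnorm, h, Real.cos_neg, Real.sin_neg,
      dehnTwist_of_snd_ne_zero hp]
    refine Prod.ext ?_ ?_
    · match_scalars
      · field_simp
        linear_combination hcs
      · field_simp
        ring
    · match_scalars
      · field_simp
        ring
      · field_simp
        linear_combination hcs

theorem bijOn_dehnTwist (n : ℕ) (g : ℝ → ℝ) :
    Set.BijOn (dehnTwist n g) (cotangentSphere n) (cotangentSphere n) :=
  Set.InvOn.bijOn (f' := dehnTwist n fun r => -g r)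
    ⟨leftInvOn_dehnTwist fun _ => rfl, leftInvOn_dehnTwist fun r => (neg_neg (g r)).symm⟩
    (mapsTo_dehnTwist n g) (mapsTo_dehnTwist n _)

theorem dehnTwist_eq_neg (h : g ‖x.2‖ = Real.pi) : dehnTwist n g x = -x := by
  by_cases hp : x.2 = 0
  · rw [dehnTwist_of_snd_eq_zero hp]
    exact Prod.ext rfl (by simp [hp])
  · rw [dehnTwist_of_snd_ne_zero hp, h]
    exact Prod.ext (by simp) (by simp)

theorem dehnTwist_eq_self (hp : x.2 ≠ 0) (h : g ‖x.2‖ = 0) : dehnTwist n g x = x := by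
  rw [dehnTwist_of_snd_ne_zero hp, h]
  exact Prod.ext (by simp) (by simp)

theorem contDiff_dehnTwist {k : WithTop ℕ∞} {ε : ℝ} (hg : ContDiff ℝ k g) (hε : 0 < ε)
    (hgπ : ∀ r < ε, g r = Real.pi) : ContDiff ℝ k (dehnTwist n g) := by
  rw [contDiff_iff_contDiffAt]
  intro x
  by_cases hp : x.2 = 0
  · have hev : dehnTwist n g =ᶠ[nhds x] fun y => -y := by
      have hopen : IsOpen {y : EuclideanSpace ℝ (Fin n) × EuclideanSpace ℝ (Fin n) | ‖y.2‖ < ε} :=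
        isOpen_lt (by fun_prop) continuous_const
      filter_upwards [hopen.mem_nhds (by simpa [hp] using hε)] with y hy
      exact dehnTwist_eq_neg (hgπ _ hy)
    exact contDiffAt_id.neg.congr_of_eventuallyEq hev
  · have hev : dehnTwist n g =ᶠ[nhds x] fun y =>
        (Real.cos (g ‖y.2‖) • y.1 + (Real.sin (g ‖y.2‖) / ‖y.2‖) • y.2,
         (-(‖y.2‖ * Real.sin (g ‖y.2‖))) • y.1 + Real.cos (g ‖y.2‖) • y.2) := by
      filter_upwards [continuous_snd.continuousAt.eventually_ne hp] with y hy
      exact dehnTwist_of_snd_ne_zero hy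
    have hnorm : ContDiffAt ℝ k
        (fun y : EuclideanSpace ℝ (Fin n) × EuclideanSpace ℝ (Fin n) => ‖y.2‖) x :=
      contDiffAt_snd.norm ℝ hp
    have hgn := hg.contDiffAt.comp x hnorm
    have hcos := Real.contDiff_cos.contDiffAt.comp x hgn
    have hsin := Real.contDiff_sin.contDiffAt.comp x hgn
    refine ContDiffAt.congr_of_eventuallyEq ?_ hev
    exact ((hcos.smul contDiffAt_fst).add
      ((hsin.div hnorm (norm_ne_zero_iff.mpr hp)).smul contDiffAt_snd)).prodMk
      (((hnorm.mul hsin).neg.smul contDiffAt_fst).add (hcos.smul contDiffAt_snd))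

end DehnTwist

/-- The model Dehn twist is smooth on all of `ℝⁿ × ℝⁿ`, maps `T*S^{n-1}` bijectively onto
itself, and is the identity for `‖p‖ ≥ R`. -/
theorem stmt_6 (n : ℕ) (hn : 2 ≤ n) (R : ℝ) (hR : 0 < R) (g : ℝ → ℝ)
    (hg : ContDiff ℝ (⊤ : ℕ∞) g)
    (hgπ : ∃ ε > (0 : ℝ), ∀ r : ℝ, r < ε → g r = Real.pi)
    (hg0 : ∀ r : ℝ, R ≤ r → g r = 0) :
    ContDiff ℝ (⊤ : ℕ∞) (dehnTwist n g) ∧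
    Set.BijOn (dehnTwist n g) (cotangentSphere n) (cotangentSphere n) ∧
    (∀ x : EuclideanSpace ℝ (Fin n) × EuclideanSpace ℝ (Fin n),
      R ≤ ‖x.2‖ → dehnTwist n g x = x) := by
  obtain ⟨ε, hε, hπ⟩ := hgπ
  exact ⟨contDiff_dehnTwist hg hε hπ, bijOn_dehnTwist n g, fun x hx =>
    dehnTwist_eq_self (norm_pos_iff.mp (hR.trans_le hx)) (hg0 _ hx)⟩
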